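/- There exists a constant c > 0 such that the following holds. For every field F of characteristic zero and all positive integers n, d, r, D, there exists a finite set H ⊆ F^n with |H| ≤ (n·d·D·(r+1) + 2)^{c·(r+1)} such that: for every m ≥ 1, every polynomial C ∈ F[y_1, …, y_m] of total degree at most D, and all T_1, …, T_m ∈ F[x_1, …, x_n] each of which is a product of at most d polynomials of total degree at most 1, with trdeg_F{T_1, …, T_m} ≤ r, the polynomial C(T_1, …, T_m) is the zero polynomial if and only if it evaluates to 0 at every point of H. -/

import Mathlib

open MvPolynomial

/-- `trdegFam F f` : the maximal cardinality of a subset of the finite family `f`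
that is algebraically independent over `F`. -/
noncomputable def trdegFam (F : Type*) {A : Type*} [CommRing F] [CommRing A] [Algebra F A]
    {m : ℕ} (f : Fin m → A) : ℕ :=
  sSup {k : ℕ | ∃ S : Finset (Fin m), S.card = k ∧
    AlgebraicIndependent F (fun i : {x // x ∈ S} => f i)}


lemma tdeg_aeval {F σ τ : Type*} [Field F] (f : σ → MvPolynomial τ F) (D : ℕ)
    (hf : ∀ i, (f i).totalDegree ≤ D) (Q : MvPolynomial σ F) :
    (aeval f Q).totalDegree ≤ D * Q.totalDegree := by
  rw [aeval_def, eval₂_eq]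
  refine totalDegree_finsetSum_le fun s hs => ?_
  refine (totalDegree_mul _ _).trans ?_
  have h1 : (algebraMap F (MvPolynomial τ F) (coeff s Q)).totalDegree = 0 := totalDegree_C _
  rw [h1, zero_add]
  refine (totalDegree_finsetProd _ _).trans ?_
  have h2 : ∑ i ∈ s.support, (f i ^ s i).totalDegree ≤ ∑ i ∈ s.support, D * s i := by
    refine Finset.sum_le_sum fun i _ => (totalDegree_pow _ _).trans ?_
    rw [mul_comm]
    exact Nat.mul_le_mul_right _ (hf i)
  refine h2.trans ?_
  rw [← Finset.mul_sum]
  exact Nat.mul_le_mul_left _ (le_totalDegree hs)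

lemma zero_patterns {F α ι : Type*} [Field F] [Fintype α] [Fintype ι] [DecidableEq ι]
    [DecidableEq F] (Δ : ℕ)
    (q : ι → MvPolynomial α F) (hq : ∀ i, (q i).totalDegree ≤ Δ) (P : Finset (Finset ι))
    (hP : ∀ Z ∈ P, ∃ a : α → F, Z = Finset.univ.filter (fun i => eval a (q i) = 0)) :
    P.card ≤ (Fintype.card ι * Δ + 1) ^ (Fintype.card α) := by
  classical
  choose! a ha using hP
  set e := Fintype.card ι * Δ with he
  let f : Finset ι → MvPolynomial α F := fun Z => ∏ i ∈ Zᶜ, q i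
  have hfdeg : ∀ Z, (f Z).totalDegree ≤ e := by
    intro Z
    refine (totalDegree_finsetProd _ _).trans ?_
    refine (Finset.sum_le_card_nsmul _ _ Δ fun i _ => hq i).trans ?_
    rw [smul_eq_mul]
    exact Nat.mul_le_mul_right _ (Finset.card_le_univ _)
  let mk : (α → Fin (e+1)) → (α →₀ ℕ) := fun v => Finsupp.equivFunOnFinite.symm (fun i => (v i : ℕ))
  let L : MvPolynomial α F →ₗ[F] ((α → Fin (e+1)) → F) :=
    LinearMap.pi fun v => lcoeff F (mk v)
  have hL : ∀ p : MvPolynomial α F, p.totalDegree ≤ e → L p = 0 → p = 0 := by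
    intro p hp h
    ext s
    rw [coeff_zero]
    by_contra hs
    have hs' : s ∈ p.support := by simpa using hs
    have h1 : ∀ i, s i < e + 1 := by
      intro i
      have := le_totalDegree hs'
      have h2 : s i ≤ s.sum fun _ e => e := by
        by_cases hi : i ∈ s.support
        · exact Finset.single_le_sum (f := fun i => s i) (fun _ _ => Nat.zero_le _) hi
        · simp at hi; omega
      omega
    have h3 := congrFun h (fun i => ⟨s i, h1 i⟩)
    apply hs
    have h4 : mk (fun i => ⟨s i, h1 i⟩) = s := by ext i; simp [mk]
    simpa [L, h4] using h3
  have hli : LinearIndependent F (fun Z : P => L (f Z)) := by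
    rw [Fintype.linearIndependent_iff]
    intro c hc
    have h0 : ∑ Z : P, c Z • f Z = 0 := by
      apply hL
      · refine totalDegree_finsetSum_le fun Z _ => (totalDegree_smul_le _ _).trans (hfdeg _)
      · simpa using hc
    by_contra! hne
    obtain ⟨Z0, hZ0⟩ := hne
    obtain ⟨Z, hZ, hmax⟩ := (Finset.univ.filter (fun Z : P => c Z ≠ 0)).exists_max_image
      (fun Z => (Z : Finset ι).card) ⟨Z0, by simpa using hZ0⟩
    have h1 := congrArg (eval (a Z)) h0
    rw [map_sum, map_zero, Finset.sum_eq_single Z] at h1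
    · rw [smul_eval, mul_eq_zero] at h1
      rcases h1 with h1 | h1
      · simp at hZ; exact hZ h1
      · simp only [f, map_prod, Finset.prod_eq_zero_iff] at h1
        obtain ⟨i, hi, hi2⟩ := h1
        rw [Finset.mem_compl, ha Z Z.2] at hi
        simp at hi
        exact hi hi2
    · intro Z' _ hne
      rw [smul_eval]
      by_cases hc' : c Z' = 0
      · simp [hc']
      have hcard := hmax Z' (by simpa using hc')
      have : ¬ (Z : Finset ι) ⊆ Z' := by
        intro hsub
        exact hne (Subtype.ext (Finset.eq_of_subset_of_card_le hsub hcard).symm)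
      obtain ⟨i, hi, hi'⟩ := Finset.not_subset.mp this
      have hz : eval (a Z) (q i) = 0 := by
        rw [ha Z Z.2] at hi
        simpa using hi
      have : eval (a Z) (f Z') = 0 := by
        simp only [f, map_prod]
        exact Finset.prod_eq_zero (Finset.mem_compl.mpr hi') hz
      rw [this, mul_zero]
    · simp
  have := hli.fintype_card_le_finrank
  simpa using this

lemma hitting_generic {F α : Type*} [Field F] [Infinite F] [Fintype α] (p : ℕ)
    (Q : MvPolynomial (α ⊕ Fin p) F) :
    ∃ B : Finset (Fin p → F), B.card ≤ 2 * ((p + 1) * Fintype.card α + 1) ∧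
      ∀ a : α → F, (∃ b, eval (Sum.elim a b) Q ≠ 0) → ∃ b ∈ B, eval (Sum.elim a b) Q ≠ 0 := by
  classical
  set e := Q.totalDegree + 1 with he
  set N := Fintype.card α with hN
  set K := e ^ 2 + 1 with hK
  set t := (p + 1) * N + 1 with ht
  obtain ⟨S, hS⟩ := Infinite.exists_subset_card_eq F K
  let G : Finset (Fin p → F) := Fintype.piFinset fun _ => S
  have hG : G.card = K ^ p := by simp [G, hS]
  let qa : (Fin p → F) → MvPolynomial α F := fun b => aeval (Sum.elim X (fun i => C (b i))) Q
  let qb : (α → F) → MvPolynomial (Fin p) F := fun a => aeval (Sum.elim (fun i => C (a i)) X) Q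
  have hqa : ∀ a b, eval a (qa b) = eval (Sum.elim a b) Q := by
    intro a b
    simp only [qa]
    rw [← coe_aeval_eq_eval, RingHom.coe_coe, comp_aeval_apply, ← coe_aeval_eq_eval, RingHom.coe_coe]
    congr 2
    ext i; rcases i with i | i <;> simp
  have hqb : ∀ a b, eval b (qb a) = eval (Sum.elim a b) Q := by
    intro a b
    simp only [qb]
    rw [← coe_aeval_eq_eval, RingHom.coe_coe, comp_aeval_apply, ← coe_aeval_eq_eval, RingHom.coe_coe]
    congr 2
    ext i; rcases i with i | i <;> simp
  have hda : ∀ b, (qa b).totalDegree ≤ e := by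
    intro b
    refine (tdeg_aeval _ 1 ?_ Q).trans (by omega)
    rintro (i | i) <;> simp
  have hdb : ∀ a, (qb a).totalDegree ≤ e := by
    intro b
    refine (tdeg_aeval _ 1 ?_ Q).trans (by omega)
    rintro (i | i) <;> simp
  let zs : (α → F) → Finset G := fun a => Finset.univ.filter (fun g => eval a (qa g) = 0)
  let P : Finset (Finset G) := Finset.univ.filter
    (fun Z => ∃ a, (∃ b, eval (Sum.elim a b) Q ≠ 0) ∧ Z = zs a)
  have hPcard : P.card ≤ K ^ ((p+1) * N) := by
    have := zero_patterns e (fun g : G => qa g) (fun g => hda g) P (by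
      intro Z hZ
      simp only [P, Finset.mem_filter] at hZ
      obtain ⟨_, a, _, h⟩ := hZ
      exact ⟨a, h⟩)
    refine this.trans ?_
    rw [Fintype.card_coe, hG, pow_mul]
    refine Nat.pow_le_pow_left ?_ _
    have hKe : e + 1 ≤ K := by nlinarith
    have : 1 ≤ K ^ p := Nat.one_le_pow _ _ (by omega)
    calc K ^ p * e + 1 ≤ K ^ p * (e + 1) := by nlinarith
      _ ≤ K ^ p * K := Nat.mul_le_mul_left _ hKe
      _ = _ := (pow_succ _ _).symm
  have hZcard : ∀ Z ∈ P, Z.card * K ≤ e * G.card := by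
    intro Z hZ
    simp only [P, Finset.mem_filter] at hZ
    obtain ⟨_, a, ⟨b, hb⟩, h⟩ := hZ
    have hne : qb a ≠ 0 := by
      intro h0
      apply hb
      rw [← hqb, h0, map_zero]
    have sz := schwartz_zippel_totalDegree hne S
    have hKpos : (0 : ℚ≥0) < K := by positivity
    rw [hS, div_le_div_iff₀ (by positivity) hKpos] at sz
    have h1 : Z.card = (Finset.filter (fun f => eval f (qb a) = 0) (Fintype.piFinset fun _ => S)).card := by
      rw [h]
      simp only [zs]
      rw [← Finset.card_map (Function.Embedding.subtype _)]
      congr 1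
      ext x
      simp only [Finset.mem_map, Finset.mem_filter, Finset.mem_univ, true_and, hqa, hqb]
      constructor
      · rintro ⟨g, hg, rfl⟩
        exact ⟨g.2, hg⟩
      · rintro ⟨hx, hx2⟩
        exact ⟨⟨x, hx⟩, hx2, rfl⟩
    rw [← h1] at sz
    have sz' : Z.card * K ≤ (qb a).totalDegree * K ^ p := by exact_mod_cast sz
    rw [hG]
    exact sz'.trans (Nat.mul_le_mul_right _ (hdb a))
  -- union bound
  set s := 2 * t with hs
  have hbad : (P.biUnion fun Z => Fintype.piFinset fun _ : Fin s => Z).card < 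
      (Finset.univ : Finset (Fin s → G)).card := by
    have h1 : (P.biUnion fun Z => Fintype.piFinset fun _ : Fin s => Z).card * K ^ s ≤
        P.card * (e * G.card) ^ s := by
      calc _ ≤ (∑ Z ∈ P, Z.card ^ s) * K ^ s := by
            refine Nat.mul_le_mul_right _ (Finset.card_biUnion_le.trans (le_of_eq ?_))
            simp
        _ = ∑ Z ∈ P, (Z.card * K) ^ s := by rw [Finset.sum_mul]; simp [mul_pow]
        _ ≤ ∑ Z ∈ P, (e * G.card) ^ s := 
            Finset.sum_le_sum fun Z hZ => Nat.pow_le_pow_left (hZcard Z hZ) _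
        _ = _ := by simp
    have hKpos : 0 < K := by positivity
    have h2 : K ^ ((p+1) * N) * e ^ s < K ^ s := by
      calc K ^ ((p+1) * N) * e ^ s = K ^ ((p+1) * N) * (e ^ 2) ^ t := by rw [hs, pow_mul e]
        _ < K ^ ((p+1) * N) * K ^ t := by
            refine Nat.mul_lt_mul_of_pos_left (Nat.pow_lt_pow_left (by omega) (by omega)) (by positivity)
        _ ≤ K ^ s := by
            rw [← pow_add]
            exact Nat.pow_le_pow_right hKpos (by omega)
    have h3 : (Finset.univ : Finset (Fin s → G)).card = G.card ^ s := by simp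
    rw [h3]
    refine Nat.lt_of_mul_lt_mul_right (a := K ^ s) (h1.trans_lt ?_)
    have hGpos : 0 < G.card := by rw [hG]; positivity
    calc P.card * (e * G.card) ^ s ≤ K ^ ((p+1) * N) * (e * G.card) ^ s := Nat.mul_le_mul_right _ hPcard
      _ = (K ^ ((p+1) * N) * e ^ s) * G.card ^ s := by rw [mul_pow]; ring
      _ < K ^ s * G.card ^ s := Nat.mul_lt_mul_of_pos_right h2 (by positivity)
      _ = _ := mul_comm _ _
  obtain ⟨u, -, hu⟩ := Finset.exists_mem_notMem_of_card_lt_card hbad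
  refine ⟨Finset.univ.image (fun i => (u i : Fin p → F)), ?_, ?_⟩
  · refine Finset.card_image_le.trans ?_
    simp [hs]
  · intro a ha
    by_contra! hcon
    apply hu
    refine Finset.mem_biUnion.mpr ⟨zs a, ?_, ?_⟩
    · simp only [P, Finset.mem_filter, Finset.mem_univ, true_and]
      exact ⟨a, ha, rfl⟩
    · rw [Fintype.mem_piFinset]
      intro i
      simp only [zs, Finset.mem_filter, Finset.mem_univ, true_and]
      rw [hqa]
      exact hcon _ (Finset.mem_image_of_mem _ (Finset.mem_univ i))

lemma derivation_kills_algebraic {F A : Type*} [Field F] [CharZero F] [CommRing A] [IsDomain A]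
    [Algebra F A] (D : Derivation F A A) (u : Set A) (hu : ∀ x ∈ u, D x = 0) (x : A)
    (hx : IsAlgebraic (Algebra.adjoin F u) x) : D x = 0 := by
  have h0 : ∀ y ∈ Algebra.adjoin F u, D y = 0 := by
    intro y hy
    induction hy using Algebra.adjoin_induction with
    | mem x hx => exact hu x hx
    | algebraMap r => simp
    | add x y _ _ hx hy => simp [hx, hy]
    | mul x y _ _ hx hy => simp [hx, hy]
  let D' : Derivation (Algebra.adjoin F u) A A := Derivation.mk'
    { toFun := D
      map_add' := fun a b => map_add D a b
      map_smul' := fun b a => by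
        simp only [Subalgebra.smul_def, smul_eq_mul, Derivation.leibniz, h0 b b.2, RingHom.id_apply]
        simp } (fun a b => D.leibniz a b)
  have hD' : ∀ y, D' y = D y := fun _ => rfl
  have : CharZero (Algebra.adjoin F u) := charZero_of_injective_algebraMap
    (algebraMap F (Algebra.adjoin F u)).injective
  have key : ∀ N : ℕ, ∀ p : Polynomial (Algebra.adjoin F u), p.natDegree < N → p ≠ 0 →
      Polynomial.aeval x p = 0 → D x = 0 := by
    intro N
    induction N with
    | zero => intro p hp; omega
    | succ N ih =>
      intro p hp hp0 hpx
      by_cases hd : p.natDegree = 0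
      · exfalso
        rw [Polynomial.eq_C_of_natDegree_eq_zero hd] at hpx hp0
        rw [Polynomial.aeval_C] at hpx
        have : p.coeff 0 = 0 := Subtype.ext hpx
        rw [this] at hp0
        simp at hp0
      · have h1 := D'.map_aeval p x
        rw [hpx, map_zero, smul_eq_mul, hD'] at h1
        rcases mul_eq_zero.mp h1.symm with h | h
        · refine ih p.derivative ?_ ?_ h
          · have := Polynomial.natDegree_derivative_lt hd
            omega
          · intro h'
            exact hd (Polynomial.derivative_eq_zero.mp h')
        · exact h
  obtain ⟨p, hp0, hpx⟩ := hx
  exact key _ p (Nat.lt_succ_self _) hp0 hpx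

lemma jac_exists {F : Type} [Field F] [CharZero F] {n k : ℕ} (T : Fin k → MvPolynomial (Fin n) F)
    (hT : AlgebraicIndependent F T) :
    ∃ (b : Fin n → F) (A : Fin n → Fin k → F),
      (Matrix.of fun i j : Fin k => ∑ l, eval b (pderiv l (T i)) * A l j).det ≠ 0 := by
  classical
  obtain ⟨u, hsu, hu⟩ := exists_isTranscendenceBasis_superset (R := F) (s := Set.range T)
    ((algebraicIndependent_subtype_range hT.injective).2 hT)
  have hcard := hu.cardinalMk_eq (IsTranscendenceBasis.mvPolynomial (Fin n) F)
  obtain ⟨ε⟩ := Cardinal.eq.mp hcard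
  let z : Fin n → MvPolynomial (Fin n) F := fun i => (ε.symm i : MvPolynomial (Fin n) F)
  let M : Matrix (Fin n) (Fin n) (MvPolynomial (Fin n) F) := Matrix.of fun i l => pderiv l (z i)
  have hdet : M.det ≠ 0 := by
    intro h0
    obtain ⟨v, hv, hMv⟩ := Matrix.exists_mulVec_eq_zero_iff.mpr h0
    apply hv
    let D : Derivation F (MvPolynomial (Fin n) F) (MvPolynomial (Fin n) F) := ∑ l, v l • pderiv l
    have hD : ∀ p, D p = ∑ l, v l * pderiv l p := by
      intro p
      have := congrFun (map_sum (Derivation.coeFnAddMonoidHom (R := F) 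
        (A := MvPolynomial (Fin n) F) (M := MvPolynomial (Fin n) F))
        (fun l => v l • pderiv l) Finset.univ) p
      rw [Finset.sum_apply] at this
      exact this
    ext1 l
    have h1 : D (X l) = v l := by
      rw [hD, Finset.sum_eq_single l]
      · simp
      · intro i _ hi; simp [pderiv_X_of_ne hi.symm]
      · simp
    rw [Pi.zero_apply, ← h1]
    refine derivation_kills_algebraic D u ?_ _ ?_
    · intro x hx
      have h2 := congrFun hMv (ε ⟨x, hx⟩)
      simp only [Matrix.mulVec, dotProduct, M, Matrix.of_apply, z, Equiv.symm_apply_apply,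
        Pi.zero_apply] at h2
      rw [hD, ← h2]
      exact Finset.sum_congr rfl fun _ _ => mul_comm _ _
    · have := hu.isAlgebraic
      rw [Subtype.range_coe] at this
      exact this.1 _
  obtain ⟨b, hb⟩ : ∃ b, eval b M.det ≠ 0 := by
    by_contra! h
    exact hdet (MvPolynomial.funext fun x => by rw [h x, map_zero])
  rw [RingHom.map_det] at hb
  set Mb := (eval b).mapMatrix M with hMb
  have hinv : Mb * Mb⁻¹ = 1 := Matrix.mul_nonsing_inv _ (isUnit_iff_ne_zero.mpr hb)
  let idx : Fin k → Fin n := fun i => ε ⟨T i, hsu ⟨i, rfl⟩⟩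
  have hidx : Function.Injective idx := by
    intro i j h
    exact hT.injective (congrArg Subtype.val (ε.injective h))
  refine ⟨b, fun l j => Mb⁻¹ l (idx j), ?_⟩
  have : (Matrix.of fun i j : Fin k => ∑ l, eval b (pderiv l (T i)) * Mb⁻¹ l (idx j)) = 1 := by
    ext i j
    have h := congrFun (congrFun hinv (idx i)) (idx j)
    rw [Matrix.mul_apply] at h
    have h2 : ∀ l, Mb (idx i) l = eval b (pderiv l (T i)) := by
      intro l; simp [hMb, M, z, idx]
    simp only [h2] at h
    rw [Matrix.of_apply, h, Matrix.one_apply, Matrix.one_apply]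
    simp [hidx.eq_iff]
  rw [this, Matrix.det_one]
  exact one_ne_zero

lemma pderiv_chain {F σ τ : Type*} [Field F] [Fintype σ] (g : σ → MvPolynomial τ F) (j : τ)
    (P : MvPolynomial σ F) :
    pderiv j (aeval g P) = ∑ i, aeval g (pderiv i P) * pderiv j (g i) := by
  classical
  induction P using MvPolynomial.induction_on with
  | C a => simp
  | add p q hp hq => simp only [map_add, hp, hq, add_mul, Finset.sum_add_distrib]
  | mul_X p i h =>
    simp only [map_mul, aeval_X, pderiv_mul, h, map_add, add_mul, Finset.sum_add_distrib]
    congr 1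
    · rw [Finset.sum_mul]
      exact Finset.sum_congr rfl fun _ _ => by ring
    · rw [Finset.sum_eq_single i]
      · simp
      · intro l _ hl; simp [pderiv_X_of_ne hl.symm]
      · simp

lemma jac_indep {F : Type*} [Field F] [CharZero F] {k : ℕ} (f : Fin k → MvPolynomial (Fin k) F)
    (y : Fin k → F)
    (h : (Matrix.of fun i j : Fin k => eval y (pderiv j (f i))).det ≠ 0) :
    AlgebraicIndependent F f := by
  classical
  have hdet : (Matrix.of fun i j : Fin k => pderiv j (f i)).det ≠ 0 := by
    intro h0
    apply h
    have := congrArg (eval y) h0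
    rw [RingHom.map_det, map_zero] at this
    exact this
  rw [algebraicIndependent_iff]
  have key : ∀ N : ℕ, ∀ P : MvPolynomial (Fin k) F, (∀ m ∈ P.support, m.degree < N) →
      aeval f P = 0 → P = 0 := by
    intro N
    induction N with
    | zero =>
      intro P hP _
      rw [← support_eq_empty, Finset.eq_empty_iff_forall_notMem]
      intro m hm
      exact absurd (hP m hm) (by omega)
    | succ N ih =>
      intro P hP hPf
      have h1 : (fun i => aeval f (pderiv i P)) = 0 := by
        by_contra hne
        apply hdet
        rw [← Matrix.exists_vecMul_eq_zero_iff]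
        refine ⟨_, hne, ?_⟩
        ext1 j
        have := pderiv_chain f j P
        rw [hPf, map_zero] at this
        simp only [Matrix.vecMul, dotProduct, Matrix.of_apply, Pi.zero_apply]
        exact this.symm
      have h2 : ∀ i, pderiv i P = 0 := by
        intro i
        refine ih _ ?_ (congrFun h1 i)
        intro m hm
        rw [mem_support_iff, coeff_pderiv] at hm
        have := hP (m + Finsupp.single i 1) (mem_support_iff.mpr (left_ne_zero_of_mul hm))
        rw [map_add, Finsupp.degree_single] at this
        omega
      have h3 : P = C (coeff 0 P) := by
        ext m
        rw [coeff_C]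
        split_ifs with hm
        · rw [hm]
        · obtain ⟨i, hi⟩ : ∃ i, m i ≠ 0 := by
            by_contra! hh
            exact hm (by ext i; simp [hh i])
          have h4 := coeff_pderiv (i := i) P (m - Finsupp.single i 1)
          rw [h2 i, coeff_zero, tsub_add_cancel_of_le
            (Finsupp.single_le_iff.mpr (Nat.one_le_iff_ne_zero.mpr hi))] at h4
          rcases mul_eq_zero.mp h4.symm with h5 | h5
          · exact h5
          · exfalso
            exact Nat.cast_add_one_ne_zero _ h5
      rw [h3] at hPf ⊢
      rw [aeval_C, algebraMap_eq, C_eq_zero] at hPf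
      rw [hPf, C_0]
  intro P hP
  exact key (P.support.sup (fun m => m.degree) + 1) P
    (fun m hm => Nat.lt_succ_of_le (Finset.le_sup (f := fun m : Fin k →₀ ℕ => m.degree) hm)) hP

/-- the affine substitution -/
noncomputable def affSub {F : Type*} [Field F] {n k : ℕ} (b : Fin n → F) (A : Fin n → Fin k → F) :
    MvPolynomial (Fin n) F →ₐ[F] MvPolynomial (Fin k) F :=
  aeval (fun l => C (b l) + ∑ j, C (A l j) * X j)

lemma eval_affSub {F : Type*} [Field F] {n k : ℕ} (b : Fin n → F) (A : Fin n → Fin k → F)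
    (y : Fin k → F) (P : MvPolynomial (Fin n) F) :
    eval y (affSub b A P) = eval (fun l => b l + ∑ j, A l j * y j) P := by
  unfold affSub
  rw [← coe_aeval_eq_eval, RingHom.coe_coe, comp_aeval_apply, ← coe_aeval_eq_eval, RingHom.coe_coe]
  simp

lemma affSub_indep {F : Type*} [Field F] [CharZero F] {n k : ℕ} (T : Fin k → MvPolynomial (Fin n) F)
    (b : Fin n → F) (A : Fin n → Fin k → F)
    (h : (Matrix.of fun i j : Fin k => ∑ l, eval b (pderiv l (T i)) * A l j).det ≠ 0) :
    AlgebraicIndependent F (fun i => affSub b A (T i)) := by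
  classical
  refine jac_indep _ 0 ?_
  convert h using 3
  ext i j
  have h1 : ∀ l, pderiv j (C (b l) + ∑ j, C (A l j) * X j : MvPolynomial (Fin k) F) = C (A l j) := by
    intro l
    rw [map_add, map_sum, pderiv_C, zero_add, Finset.sum_eq_single j]
    · simp
    · intro i _ hi; simp [pderiv_X_of_ne hi]
    · simp
  have h2 := pderiv_chain (fun l => C (b l) + ∑ j, C (A l j) * X j) j (T i)
  simp only [h1] at h2
  change eval 0 (pderiv j (affSub b A (T i))) = _
  unfold affSub
  rw [h2, map_sum]
  refine Finset.sum_congr rfl fun l _ => ?_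
  rw [map_mul, eval_C]
  congr 1
  have := eval_affSub b A 0 (pderiv l (T i))
  simpa [affSub] using this

lemma linear_form {F : Type*} [Field F] {n : ℕ} (ℓ : MvPolynomial (Fin n) F)
    (h : ℓ.totalDegree ≤ 1) :
    ℓ = C (coeff 0 ℓ) + ∑ l, C (coeff (Finsupp.single l 1) ℓ) * X l := by
  classical
  ext m
  rw [coeff_add, coeff_sum, coeff_C]
  simp only [coeff_C_mul, coeff_X]
  by_cases h0 : m = 0
  · subst h0
    simp
  rw [if_neg (Ne.symm h0), zero_add]
  by_cases h1 : m.degree = 1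
  · obtain ⟨l, rfl⟩ : ∃ l, m = Finsupp.single l 1 := by
      obtain ⟨l, hl⟩ : ∃ l, m l ≠ 0 := by
        by_contra! hh
        exact h0 (by ext i; simp [hh i])
      have hle : Finsupp.single l 1 ≤ m := Finsupp.single_le_iff.mpr (Nat.one_le_iff_ne_zero.mpr hl)
      have h2 : (m - Finsupp.single l 1) + Finsupp.single l 1 = m := tsub_add_cancel_of_le hle
      have h3 := congrArg Finsupp.degree h2
      rw [map_add, Finsupp.degree_single, h1] at h3
      have h4 : m - Finsupp.single l 1 = 0 := by
        rw [← Finsupp.degree_eq_zero_iff]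
        omega
      exact ⟨l, by rw [← h2, h4, zero_add]⟩
    rw [Finset.sum_eq_single l]
    · simp
    · intro i _ hi
      rw [if_neg, mul_zero]
      intro hh
      exact hi (Finsupp.single_left_injective one_ne_zero hh)
    · simp
  · rw [Finset.sum_eq_zero]
    · apply coeff_eq_zero_of_totalDegree_lt
      have : m.degree ≠ 0 := by rwa [Ne, Finsupp.degree_eq_zero_iff]
      change _ < m.degree
      omega
    · intro i _
      rw [if_neg, mul_zero]
      rintro rfl
      simp at h1

lemma pad_prod {F : Type*} [Field F] {n d : ℕ} (T : MvPolynomial (Fin n) F)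
    (h : ∃ (d' : ℕ) (_ : d' ≤ d) (ℓ : Fin d' → MvPolynomial (Fin n) F),
            (∀ j, (ℓ j).totalDegree ≤ 1) ∧ T = ∏ j, ℓ j) :
    ∃ ℓ : Fin d → MvPolynomial (Fin n) F, (∀ j, (ℓ j).totalDegree ≤ 1) ∧ T = ∏ j, ℓ j := by
  obtain ⟨d', hd, ℓ, hℓ, rfl⟩ := h
  obtain ⟨e, rfl⟩ := Nat.exists_eq_add_of_le hd
  refine ⟨Fin.addCases ℓ (fun _ => 1), ?_, ?_⟩
  · intro j
    refine Fin.addCases (fun i => ?_) (fun i => ?_) j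
    · simpa using hℓ i
    · simp
  · simp [Fin.prod_univ_add]

lemma faithful_family (F : Type) [Field F] [CharZero F] (n d k : ℕ) :
    ∃ B : Finset ((Fin n → F) × (Fin n → Fin k → F)),
      B.card ≤ 2 * ((n + n * k + 1) * (k * (d * (n + 1))) + 1) ∧
      ∀ T : Fin k → MvPolynomial (Fin n) F,
        (∀ i, ∃ ℓ : Fin d → MvPolynomial (Fin n) F, (∀ j, (ℓ j).totalDegree ≤ 1) ∧ T i = ∏ j, ℓ j) →
        AlgebraicIndependent F T →
        ∃ q ∈ B, AlgebraicIndependent F (fun i => affSub q.1 q.2 (T i)) := by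
  classical
  have hcard : Fintype.card (Fin n ⊕ Fin n × Fin k) = n + n * k := by simp
  let e : (Fin n ⊕ Fin n × Fin k) ≃ Fin (n + n * k) := Fintype.equivFinOfCardEq hcard
  let α := Fin k × Fin d × Option (Fin n)
  let TT : Fin k → MvPolynomial (Fin n) (MvPolynomial (α ⊕ Fin (n + n * k)) F) := fun i =>
    ∏ j : Fin d, (C (X (Sum.inl (i, j, none))) + ∑ l, C (X (Sum.inl (i, j, some l))) * X l)
  let Q : MvPolynomial (α ⊕ Fin (n + n * k)) F := Matrix.det (Matrix.of fun i j : Fin k =>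
    ∑ l, eval (fun l => X (Sum.inr (e (Sum.inl l)))) (pderiv l (TT i)) * X (Sum.inr (e (Sum.inr (l, j)))))
  have hQ : ∀ (a : α → F) (c : Fin (n + n * k) → F) (T : Fin k → MvPolynomial (Fin n) F),
      (∀ i, T i = ∏ j : Fin d, (C (a (i, j, none)) + ∑ l, C (a (i, j, some l)) * X l)) →
      eval (Sum.elim a c) Q = (Matrix.of fun i j : Fin k =>
        ∑ l, eval (fun l => c (e (Sum.inl l))) (pderiv l (T i)) * c (e (Sum.inr (l, j)))).det := by
    intro a c T hT
    have hmap : ∀ i, map (eval (Sum.elim a c)) (TT i) = T i := by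
      intro i
      rw [hT i]
      simp [TT, map_prod]
    simp only [Q]
    rw [RingHom.map_det]
    congr 1
    ext i j
    simp only [RingHom.mapMatrix_apply, Matrix.map_apply, Matrix.of_apply, map_sum, map_mul, eval_X,
      Sum.elim_inr]
    refine Finset.sum_congr rfl fun l _ => ?_
    congr 1
    rw [← hmap i, pderiv_map, eval_map]
    change eval (Sum.elim a c) (eval₂ (RingHom.id _) _ _) = _
    rw [eval₂_comp_left]
    congr 1
    ext l
    simp
  obtain ⟨B, hB, hB2⟩ := hitting_generic (n + n * k) Q
  let f : (Fin (n + n * k) → F) → (Fin n → F) × (Fin n → Fin k → F) := fun c =>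
    (fun l => c (e (Sum.inl l)), fun l j => c (e (Sum.inr (l, j))))
  refine ⟨B.image f, ?_, ?_⟩
  · refine Finset.card_image_le.trans (hB.trans (le_of_eq ?_))
    simp [α]
  · intro T hT hind
    choose ℓ hℓ hTℓ using hT
    let a : α → F := fun t => match t with
      | (i, j, none) => coeff 0 (ℓ i j)
      | (i, j, some l) => coeff (Finsupp.single l 1) (ℓ i j)
    have hTa : ∀ i, T i = ∏ j : Fin d, (C (a (i, j, none)) + ∑ l, C (a (i, j, some l)) * X l) := by
      intro i
      rw [hTℓ i]
      exact Finset.prod_congr rfl fun j _ => linear_form _ (hℓ i j)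
    obtain ⟨b, A, hbA⟩ := jac_exists T hind
    have hex : ∃ c, eval (Sum.elim a c) Q ≠ 0 := by
      refine ⟨fun t => Sum.elim b (fun x => A x.1 x.2) (e.symm t), ?_⟩
      rw [hQ a _ T hTa]
      simpa using hbA
    obtain ⟨c, hc, hcQ⟩ := hB2 a hex
    rw [hQ a c T hTa] at hcQ
    exact ⟨f c, Finset.mem_image_of_mem _ hc, affSub_indep T _ _ hcQ⟩

lemma exists_basis {F : Type} [Field F] {n m : ℕ} (T : Fin m → MvPolynomial (Fin n) F) (r : ℕ)
    (h : trdegFam F T ≤ r) :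
    ∃ (k : ℕ) (τ : Fin k → Fin m), k ≤ r ∧ AlgebraicIndependent F (fun i => T (τ i)) ∧
      ∀ C : MvPolynomial (Fin m) F, 
        IsAlgebraic (Algebra.adjoin F (Set.range (fun i => T (τ i)))) (aeval T C) := by
  classical
  obtain ⟨B, hB⟩ := (AlgebraicIndependent.matroid F (MvPolynomial (Fin n) F)).exists_isBasis
    (Set.range T)
  obtain ⟨hind, hsub, -⟩ := AlgebraicIndependent.matroid_isBasis_iff.mp hB
  have hfin : B.Finite := (Set.finite_range T).subset hsub
  have : Fintype B := hfin.fintype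
  choose σ hσ using fun x : B => hsub x.2
  let ε : Fin (Fintype.card B) ≃ B := (Fintype.equivFin B).symm
  let τ : Fin (Fintype.card B) → Fin m := fun i => σ (ε i)
  have hτ : ∀ i, T (τ i) = ε i := fun i => hσ (ε i)
  have hrange : Set.range (fun i => T (τ i)) = B := by
    simp only [hτ]
    ext x
    constructor
    · rintro ⟨i, rfl⟩; exact (ε i).2
    · intro hx; exact ⟨ε.symm ⟨x, hx⟩, by simp⟩
  have hind' : AlgebraicIndependent F (fun i => T (τ i)) := by
    simp only [hτ]
    exact (algebraicIndependent_equiv ε).2 hind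
  have hτinj : Function.Injective τ := fun i j hij => hind'.injective (by simp [hij])
  refine ⟨Fintype.card B, τ, ?_, hind', ?_⟩
  · refine le_trans ?_ h
    refine le_csSup ⟨m, ?_⟩ ⟨Finset.univ.image τ, ?_, ?_⟩
    · rintro k ⟨S, rfl, -⟩
      simpa using Finset.card_le_univ S
    · rw [Finset.card_image_of_injective _ hτinj]; simp
    · let η : Fin (Fintype.card B) ≃ {x // x ∈ Finset.univ.image τ} :=
        Equiv.ofBijective (fun i => ⟨τ i, by simp⟩) ⟨fun i j hij => hτinj (by simpa using hij), by
          rintro ⟨x, hx⟩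
          simp only [Finset.mem_image, Finset.mem_univ, true_and] at hx
          obtain ⟨i, rfl⟩ := hx
          exact ⟨i, rfl⟩⟩
      exact (algebraicIndependent_equiv' η rfl).1 hind'
  · intro C
    rw [hrange, AlgebraicIndependent.isAlgebraic_adjoin_iff_of_matroid_isBasis hB]
    have hmem : aeval T C ∈ Algebra.adjoin F (Set.range T) := by
      rw [Algebra.adjoin_range_eq_range_aeval]
      exact ⟨C, rfl⟩
    exact isAlgebraic_algebraMap (⟨_, hmem⟩ : Algebra.adjoin F (Set.range T))

lemma faithful_ne_zero {F A A' : Type*} [Field F] [CommRing A] [IsDomain A] [Algebra F A] 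
    [CommRing A'] [Algebra F A'] {k : ℕ}
    (t : Fin k → A) (Φ : A →ₐ[F] A') (h : AlgebraicIndependent F (fun i => Φ (t i))) (g : A)
    (hg : IsAlgebraic (Algebra.adjoin F (Set.range t)) g) (hg0 : g ≠ 0) : Φ g ≠ 0 := by
  obtain ⟨⟨s, hs⟩, hs0, hdvd⟩ := hg.exists_nonzero_dvd (mem_nonZeroDivisors_of_ne_zero hg0)
  rw [Algebra.adjoin_range_eq_range_aeval] at hs
  obtain ⟨p, hp⟩ := hs
  intro h0
  have h1 : Φ g ∣ Φ s := map_dvd Φ hdvd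
  rw [h0, zero_dvd_iff, ← hp] at h1
  have h2 : aeval (fun i => Φ (t i)) p = 0 := by
    rw [← h1]
    exact (comp_aeval_apply _ _ _).symm
  have h3 : p = 0 := algebraicIndependent_iff.mp h p h2
  apply hs0
  apply Subtype.ext
  rw [h3] at hp
  simpa using hp.symm

lemma hitting_k (F : Type) [Field F] [CharZero F] (n d D k : ℕ) :
    ∃ H : Finset (Fin n → F), 
      H.card ≤ 2 * ((n + n * k + 1) * (k * (d * (n + 1))) + 1) * (d * D + 1) ^ k ∧
      ∀ (m : ℕ) (C : MvPolynomial (Fin m) F), C.totalDegree ≤ D →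
        ∀ (T : Fin m → MvPolynomial (Fin n) F),
          (∀ i, ∃ ℓ : Fin d → MvPolynomial (Fin n) F, (∀ j, (ℓ j).totalDegree ≤ 1) ∧ T i = ∏ j, ℓ j) →
          ∀ τ : Fin k → Fin m, AlgebraicIndependent F (fun i => T (τ i)) →
          IsAlgebraic (Algebra.adjoin F (Set.range (fun i => T (τ i)))) (aeval T C) →
          aeval T C ≠ 0 → ∃ p ∈ H, eval p (aeval T C) ≠ 0 := by
  classical
  obtain ⟨B, hB, hB2⟩ := faithful_family F n d k
  obtain ⟨S, hS⟩ := Infinite.exists_subset_card_eq F (d * D + 1)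
  let G : Finset (Fin k → F) := Fintype.piFinset fun _ => S
  have hG : G.card = (d * D + 1) ^ k := by simp [G, hS]
  refine ⟨(B ×ˢ G).image (fun x => fun l => x.1.1 l + ∑ j, x.1.2 l j * x.2 j), ?_, ?_⟩
  · refine Finset.card_image_le.trans ?_
    rw [Finset.card_product, hG]
    exact Nat.mul_le_mul_right _ hB
  · intro m C hC T hT τ hind halg hne
    obtain ⟨q, hq, hqind⟩ := hB2 (fun i => T (τ i)) (fun i => hT (τ i)) hind
    have h1 := faithful_ne_zero (fun i => T (τ i)) (affSub q.1 q.2) hqind _ halg hne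
    have hTdeg : ∀ i, (affSub q.1 q.2 (T i)).totalDegree ≤ d := by
      intro i
      have h2 : (affSub q.1 q.2 (T i)).totalDegree ≤ 1 * (T i).totalDegree := by
        refine tdeg_aeval _ 1 (fun l => ?_) _
        refine (totalDegree_add _ _).trans (max_le (by simp) ?_)
        refine totalDegree_finsetSum_le fun j _ => (totalDegree_mul _ _).trans ?_
        simp
      obtain ⟨ℓ, hℓ, hTℓ⟩ := hT i
      refine h2.trans ?_
      rw [one_mul, hTℓ]
      refine (totalDegree_finsetProd _ _).trans ?_
      refine (Finset.sum_le_card_nsmul _ _ 1 fun j _ => hℓ j).trans ?_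
      simp
    have hdeg : (affSub q.1 q.2 (aeval T C)).totalDegree ≤ d * D := by
      rw [comp_aeval_apply]
      exact (tdeg_aeval _ d hTdeg C).trans (Nat.mul_le_mul_left _ hC)
    by_contra! hcon
    apply h1
    refine eq_zero_of_eval_zero_at_prod_finset _ (fun _ => S) ?_ ?_
    · intro i
      rw [hS]
      exact Nat.lt_succ_of_le ((degreeOf_le_totalDegree _ _).trans hdeg)
    · intro y hy
      rw [eval_affSub]
      refine hcon _ (Finset.mem_image.mpr ⟨(q, y), ?_, rfl⟩)
      exact Finset.mem_product.mpr ⟨hq, Fintype.mem_piFinset.mpr hy⟩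

lemma final_bound (n d r D : ℕ) (hn : 0 < n) (hd : 0 < d) (hD : 0 < D) :
    (r + 1) * (2 * ((n + n * r + 1) * (r * (d * (n + 1))) + 1) * (d * D + 1) ^ r)
      ≤ (n * d * D * (r + 1) + 2) ^ (5 * (r + 1)) := by
  set Y := n * d * D * (r + 1) + 2 with hY
  have hnd : 1 ≤ n * d := Nat.mul_pos hn hd
  have hndD : 1 ≤ n * d * D := Nat.mul_pos hnd hD
  have h1 : r + 1 ≤ Y := by nlinarith
  have h2 : n + n * r + 1 ≤ Y := by
    have : n * (r + 1) * 1 ≤ n * (r + 1) * (d * D) := Nat.mul_le_mul_left _ (Nat.mul_pos hd hD)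
    nlinarith
  have h3 : r * d ≤ Y := by
    have : d * (r + 1) * 1 ≤ d * (r + 1) * (n * D) := Nat.mul_le_mul_left _ (Nat.mul_pos hn hD)
    nlinarith
  have h4 : n + 1 ≤ Y := by nlinarith
  have h5 : d * D + 1 ≤ Y := by
    have : d * D * 1 ≤ d * D * (n * (r + 1)) := Nat.mul_le_mul_left _ (Nat.mul_pos hn (Nat.succ_pos r))
    nlinarith
  have h6 : 3 ≤ Y := by nlinarith
  have h7 : 2 * ((n + n * r + 1) * (r * (d * (n + 1))) + 1) ≤ Y ^ 4 := by
    have : (n + n * r + 1) * (r * (d * (n + 1))) ≤ Y ^ 3 := by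
      calc _ = (n + n * r + 1) * (r * d) * (n + 1) := by ring
        _ ≤ Y * Y * Y := Nat.mul_le_mul (Nat.mul_le_mul h2 h3) h4
        _ = _ := by ring
    have h8 : 3 ^ 3 ≤ Y ^ 3 := Nat.pow_le_pow_left h6 3
    have h9 : Y ^ 3 * 3 ≤ Y ^ 3 * Y := Nat.mul_le_mul_left _ h6
    have : Y ^ 4 = Y ^ 3 * Y := by ring
    omega
  calc _ ≤ Y * (Y ^ 4 * Y ^ r) := 
        Nat.mul_le_mul h1 (Nat.mul_le_mul h7 (Nat.pow_le_pow_left h5 r))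
    _ = Y ^ (r + 5) := by ring
    _ ≤ _ := Nat.pow_le_pow_right (by omega) (by omega)

theorem statement15 :
    ∃ c : ℝ, 0 < c ∧
      ∀ (F : Type) [Field F] [CharZero F],
      ∀ (n d r D : ℕ), 0 < n → 0 < d → 0 < r → 0 < D →
      ∃ H : Finset (Fin n → F),
        (H.card : ℝ) ≤ ((n * d * D * (r + 1) + 2 : ℕ) : ℝ) ^ (c * (r + 1 : ℕ)) ∧
        ∀ (m : ℕ), 1 ≤ m →
        ∀ (C : MvPolynomial (Fin m) F), C.totalDegree ≤ D →
        ∀ (T : Fin m → MvPolynomial (Fin n) F),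
          (∀ i, ∃ (d' : ℕ) (_ : d' ≤ d) (ℓ : Fin d' → MvPolynomial (Fin n) F),
            (∀ j, (ℓ j).totalDegree ≤ 1) ∧ T i = ∏ j, ℓ j) →
          trdegFam F T ≤ r →
          (aeval T C = 0 ↔ ∀ p ∈ H, eval p (aeval T C) = 0) := by
  refine ⟨5, by norm_num, ?_⟩
  intro F _ _ n d r D hn hd hr hD
  classical
  choose Hk hHk hHk2 using fun k => hitting_k F n d D k
  refine ⟨(Finset.range (r + 1)).biUnion Hk, ?_, ?_⟩
  · have h1 : ((Finset.range (r + 1)).biUnion Hk).card ≤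
        (n * d * D * (r + 1) + 2) ^ (5 * (r + 1)) := by
      refine le_trans ?_ (final_bound n d r D hn hd hD)
      refine (Finset.card_biUnion_le_card_mul _ _ _ (fun k hk => ?_)).trans (by rw [Finset.card_range])
      refine (hHk k).trans ?_
      have hkr : k ≤ r := Nat.lt_succ_iff.mp (Finset.mem_range.mp hk)
      gcongr
      omega
    have h2 : ((n * d * D * (r + 1) + 2 : ℕ) : ℝ) ^ ((5 : ℝ) * (r + 1 : ℕ)) =
        (((n * d * D * (r + 1) + 2) ^ (5 * (r + 1)) : ℕ) : ℝ) := by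
      rw [Nat.cast_pow, ← Real.rpow_natCast]
      congr 1
      push_cast
      ring
    rw [h2]
    exact_mod_cast h1
  · intro m _ P hP T hT htr
    constructor
    · intro h p _
      rw [h, map_zero]
    · intro h
      by_contra hne
      obtain ⟨k, τ, hk, hind, halg⟩ := exists_basis T r htr
      obtain ⟨p, hp, hpe⟩ := hHk2 k m P hP T (fun i => pad_prod _ (hT i)) τ hind (halg P) hne
      exact hpe (h p (Finset.mem_biUnion.mpr ⟨k, Finset.mem_range.mpr (by omega), hp⟩))
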